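/- Let L ⊆ ℝP^n be a projective subspace and A ⊆ ℝP^n a set with A ∩ L = ∅ such that for every projective subspace N with L ⊆ N and dim N = dim L + 1, the section A ∩ N is a projectively separable subset of the projective space N. Then (A^⊥_L)^⊥_{L*} ⊆ A (identifying ((ℝP^n)*)* with ℝP^n). -/

import Mathlib

open Module Set Pointwise

noncomputable section

namespace CC

/-- The underlying vector space of `ℝPⁿ`. -/
abbrev Vec (n : ℕ) : Type := Fin (n + 1) → ℝ

/-- Real projective `n`-space `ℝPⁿ = ℙ(ℝ^{n+1})`. -/
abbrev Pt (n : ℕ) : Type := Projectivization ℝ (Vec n)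

/-- The dual projective space `(ℝPⁿ)*`, whose points are the hyperplanes of `ℝPⁿ`. -/
abbrev DPt (n : ℕ) : Type := Projectivization ℝ (Module.Dual ℝ (Vec n))

/-- The quotient topology on a projectivization. -/
instance projTop {K V : Type*} [DivisionRing K] [AddCommGroup V] [Module K V]
    [TopologicalSpace V] : TopologicalSpace (Projectivization K V) :=
  instTopologicalSpaceQuotient

/-- The canonical topology on the dual of `ℝ^{n+1}` (transported through any linear
coordinate system; all bases induce the same topology). -/
instance dualTop (n : ℕ) : TopologicalSpace (Module.Dual ℝ (Vec n)) :=
  TopologicalSpace.induced (Module.finBasis ℝ (Module.Dual ℝ (Vec n))).equivFun inferInstance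

variable {M : Type*} [AddCommGroup M] [Module ℝ M]

/-- The point `x ∈ ℙ(M)` lies on the hyperplane corresponding to the point `π` of the
dual projective space `ℙ(M*)` (i.e. `x` is in the projectivization of the kernel of any
functional representing `π`). -/
def Incident (π : Projectivization ℝ (Module.Dual ℝ M)) (x : Projectivization ℝ M) : Prop :=
  π.rep x.rep = 0

/-- The projectively dual set `S*_p ⊆ P*`: the set of all hyperplanes of `P`
disjoint from `S`. -/
def dualSet (A : Set (Projectivization ℝ M)) : Set (Projectivization ℝ (Module.Dual ℝ M)) :=
  {π | ∀ x ∈ A, ¬Incident π x}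

/-- Projective separability: every point of the complement of `S` lies on a hyperplane
disjoint from `S`. -/
def ProjSeparable (A : Set (Projectivization ℝ M)) : Prop :=
  ∀ x ∉ A, ∃ π : Projectivization ℝ (Module.Dual ℝ M), Incident π x ∧ ∀ y ∈ A, ¬Incident π y

/-- The projective subspace of `ℙ(M)` associated to a linear subspace `W ≤ M`. -/
def projSet (W : Submodule ℝ M) : Set (Projectivization ℝ M) :=
  {x | x.rep ∈ W}

/-- The canonical identification `ℙ(M) → ℙ(M**)` induced by the canonical isomorphism
`M ≃ M**`. -/
def toDoubleDual [FiniteDimensional ℝ M] :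
    Projectivization ℝ M → Projectivization ℝ (Module.Dual ℝ (Module.Dual ℝ M)) :=
  Projectivization.map (Module.evalEquiv ℝ M).toLinearMap (Module.evalEquiv ℝ M).injective

/-- The `L`-dual set `A^⊥_L ⊆ ℙ(M*)` of a set `A ⊆ ℙ(M)` (for `L = ℙ(W)`): the set of
all hyperplanes `π` of `ℙ(M)` meeting every section `A ∩ N` by a projective subspace
`N ⊇ L` with `dim N = dim L + 1`. -/
def LdualSet (W : Submodule ℝ M) (A : Set (Projectivization ℝ M)) :
    Set (Projectivization ℝ (Module.Dual ℝ M)) :=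
  {π | ∀ N : Submodule ℝ M, W ≤ N → finrank ℝ N = finrank ℝ W + 1 →
    ∃ x ∈ A, Incident π x ∧ x.rep ∈ N}

/-- `(A^⊥_L)^⊥_{L*}`, brought back from `ℙ(M**)` to `ℙ(M)` via the canonical
identification `M ≅ M**`. -/
def Lbidual [FiniteDimensional ℝ M] (W : Submodule ℝ M) (A : Set (Projectivization ℝ M)) :
    Set (Projectivization ℝ M) :=
  toDoubleDual ⁻¹' LdualSet W.dualAnnihilator (LdualSet W A)

/-- The image of a set `A ⊆ ℙ(M)` under the projection from the center `ℙ(W)`: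
`y` is in the image iff some point `x ∈ A` not in the center projects to `y`
(i.e. the class of a representing vector of `x` spans the line `y`). -/
def projImage (W : Submodule ℝ M) (A : Set (Projectivization ℝ M)) :
    Set (Projectivization ℝ (M ⧸ W)) :=
  {y | ∃ x ∈ A, x.rep ∉ W ∧ W.mkQ x.rep ∈ y.submodule}

/-- The coordinate, in the affine chart of `ℙ(M)` given by a functional `φ`
(the complement of the hyperplane `ℙ(ker φ)`, identified with `{v | φ v = 1}`),
of a point `x` with `φ x.rep ≠ 0`. -/
def projChart (φ : Module.Dual ℝ M) (x : Projectivization ℝ M) : M :=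
  (φ x.rep)⁻¹ • x.rep

/-- A convex subset of a projective space: a set disjoint from some hyperplane and
convex in the corresponding affine chart. -/
def IsProjConvex (A : Set (Projectivization ℝ M)) : Prop :=
  ∃ φ : Module.Dual ℝ M, φ ≠ 0 ∧ (∀ x ∈ A, φ x.rep ≠ 0) ∧ Convex ℝ (projChart φ '' A)

/-- `L`-convex-concavity of a closed set `A ⊆ ℙ(M)` with respect to the projective
subspace `L = ℙ(W)`: `A` is closed, disjoint from `L`, all sections of `A` by
projective subspaces `N ⊇ L` with `dim N = dim L + 1` are nonempty and convex, and the
complement of the projection of `A` from any center `T ⊂ L` with `dim T = dim L − 1`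
is open and convex. -/
def IsLConvexConcave [TopologicalSpace M] (W : Submodule ℝ M)
    (A : Set (Projectivization ℝ M)) : Prop :=
  IsClosed A ∧ (∀ x ∈ A, x.rep ∉ W) ∧
    (∀ N : Submodule ℝ M, W ≤ N → finrank ℝ N = finrank ℝ W + 1 →
      (A ∩ projSet N).Nonempty ∧ IsProjConvex (A ∩ projSet N)) ∧
    (∀ T : Submodule ℝ M, T ≤ W → finrank ℝ T + 1 = finrank ℝ W →
      IsOpen (projImage T A)ᶜ ∧ IsProjConvex (projImage T A)ᶜ)

/-- The lift of a hyperplane `π` of `ℙ(M)` containing the center `ℙ(Q)` to a hyperplane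
of the quotient projective space `ℙ(M ⧸ Q)`. -/
def liftHyperplane (Q : Submodule ℝ M) (π : Projectivization ℝ (Module.Dual ℝ M))
    (h : ∀ v ∈ Q, π.rep v = 0) : Projectivization ℝ (Module.Dual ℝ (M ⧸ Q)) :=
  Projectivization.mk ℝ (Q.liftQ π.rep fun v hv => LinearMap.mem_ker.mpr (h v hv))
    (fun hz => π.rep_nonzero (by
      have h2 := Submodule.liftQ_mkQ Q π.rep (fun v hv => LinearMap.mem_ker.mpr (h v hv))
      rw [hz] at h2
      simpa using h2.symm))

/-- Affine separability of a set `B`, inside the affine chart of `ℙ(M)` given by a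
functional `φ`: every point of the chart outside `B` lies in a closed half-space of the
chart (cut out by an affine function which is nonconstant on the chart) disjoint
from `B`.  A closed half-space of the chart `{v | φ v = 1}` is cut out by a functional
`g` (nonproportional to `φ`, so that `g` is nonconstant on the chart) via the
scale-invariant condition `g(x)/φ(x) ≥ 0`. -/
def AffSepInChart (φ : Module.Dual ℝ M) (B : Set (Projectivization ℝ M)) : Prop :=
  ∀ y : Projectivization ℝ M, φ y.rep ≠ 0 → y ∉ B →
    ∃ g : Module.Dual ℝ M, (∀ c : ℝ, g ≠ c • φ) ∧ 0 ≤ g y.rep / φ y.rep ∧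
      ∀ z ∈ B, g z.rep / φ z.rep < 0

/-- `A` is coseparable relative to `L = ℙ(W)`: `A` is disjoint from `L`, and for every
hyperplane `L₁` of `L`, the complement of the projection of `A` from the center `L₁`
misses some hyperplane of `ℝPⁿ/L₁` and is affinely separable in the corresponding
affine chart. -/
def Coseparable (W : Submodule ℝ M) (A : Set (Projectivization ℝ M)) : Prop :=
  (∀ x ∈ A, x.rep ∉ W) ∧
    ∀ W₁ : Submodule ℝ M, W₁ ≤ W → finrank ℝ W₁ + 1 = finrank ℝ W →
      ∃ φ : Module.Dual ℝ (M ⧸ W₁), φ ≠ 0 ∧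
        (∀ y ∈ (projImage W₁ A)ᶜ, φ y.rep ≠ 0) ∧
        AffSepInChart φ (projImage W₁ A)ᶜ

/-- A set `S` contained in the projective subspace `N = ℙ(Nsub)`, disjoint from the
hyperplane `L = ℙ(W)` of `N`, is pointed with respect to `Δ ⊆ L` if it has two vertices
`a, b ∈ S` such that a hyperplane `p` of `N` disjoint from `Δ` meets `S` iff it meets
the straight segment joining `a` and `b` in the affine chart `N ∖ L` (the chart being
given by any functional vanishing on `W` and nonzero at `a` and `b`). -/
def PointedWrt (W Nsub : Submodule ℝ M) (Δ S : Set (Projectivization ℝ M)) : Prop :=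
  ∃ a ∈ S, ∃ b ∈ S,
    ∀ P : Submodule ℝ M, P ≤ Nsub → finrank ℝ P + 1 = finrank ℝ Nsub →
      (∀ x ∈ Δ, x.rep ∉ P) →
      ((∃ x ∈ S, x.rep ∈ P) ↔
        ∀ φ : Module.Dual ℝ M, (∀ w ∈ W, φ w = 0) → φ a.rep ≠ 0 → φ b.rep ≠ 0 →
          ∃ t ∈ Icc (0 : ℝ) 1,
            t • ((φ a.rep)⁻¹ • a.rep) + (1 - t) • ((φ b.rep)⁻¹ • b.rep) ∈ P)

/-- The hyperplane `Γ_c` of `ℙ(M)` containing the center `ℙ(W)` and corresponding to the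
point `c` of `ℙ(M ⧸ W)`. -/
def gammaSet (W : Submodule ℝ M) (c : Projectivization ℝ (M ⧸ W)) :
    Set (Projectivization ℝ M) :=
  {x | W.mkQ x.rep ∈ c.submodule}

/-- The surgery `S_{[a,b]}(A)` of a set `A ⊆ ℙ(M)` along the arc `Arc = [a,b]` of the
projective line `ℙ(M ⧸ W)`, computed in the affine chart given by a functional `φ`
whose kernel is the cone of the hyperplane `Γ_c` (for a point `c ∉ Arc`): points
projecting into `Arc` are replaced by the convex hull of `(A ∩ Γ_a) ∪ (A ∩ Γ_b)` taken
in the chart, points projecting outside `Arc` are kept iff they belong to `A`, and the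
result is disjoint from `ℙ(W)`. -/
def surgery (W : Submodule ℝ M) (a b : Projectivization ℝ (M ⧸ W))
    (Arc : Set (Projectivization ℝ (M ⧸ W))) (φ : Module.Dual ℝ M)
    (A : Set (Projectivization ℝ M)) : Set (Projectivization ℝ M) :=
  {x | x.rep ∉ W ∧
    ((∃ y ∈ Arc, W.mkQ x.rep ∈ y.submodule) →
      φ x.rep ≠ 0 ∧
        projChart φ x ∈ convexHull ℝ (projChart φ '' (A ∩ (gammaSet W a ∪ gammaSet W b)))) ∧
    ((¬∃ y ∈ Arc, W.mkQ x.rep ∈ y.submodule) → x ∈ A)}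

/-- The linear map `M* ⧸ T → Q*` (for `Q = ℙ(T)*`-perp, i.e. `Q = T.dualCoannihilator`)
realizing the canonical identification of `(ℝPⁿ)*/T` with the space of hyperplanes of
the projective space `ℙ(Q)`: the class of a hyperplane `π ⊅ Q` of `ℝPⁿ` corresponds to
the hyperplane `π ∩ ℙ(Q)` of `ℙ(Q)`. -/
def restrictToSub (T : Submodule ℝ (Module.Dual ℝ M)) :
    (Module.Dual ℝ M ⧸ T) →ₗ[ℝ] Module.Dual ℝ T.dualCoannihilator :=
  T.liftQ (T.dualCoannihilator.subtype.dualMap)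
    (fun φ hφ => LinearMap.mem_ker.mpr
      (LinearMap.ext fun q => (Submodule.mem_dualCoannihilator _).mp q.2 φ hφ))

/-- Incidence with a point of the bidual is evaluation. -/
theorem incident_toDoubleDual [FiniteDimensional ℝ M] (x : Projectivization ℝ M)
    (π : Projectivization ℝ (Module.Dual ℝ M)) (h : Incident (toDoubleDual x) π) :
    π.rep x.rep = 0 := by
  have hne : (Module.evalEquiv ℝ M).toLinearMap x.rep ≠ 0 := by
    exact fun h => x.rep_nonzero ((Module.evalEquiv ℝ M).map_eq_zero_iff.mp h)
  have hx : toDoubleDual x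
      = Projectivization.mk ℝ ((Module.evalEquiv ℝ M).toLinearMap x.rep) hne := by
    conv_lhs => rw [← x.mk_rep]
    rfl
  unfold Incident at h
  rw [hx] at h
  obtain ⟨a, ha⟩ := Projectivization.exists_smul_eq_mk_rep ℝ _ hne
  rw [← ha] at h
  have h2 : (a : ℝ) * π.rep x.rep = 0 := h
  exact (mul_eq_zero.mp h2).resolve_left a.ne_zero

/-- The `L`-dual set is disjoint from `L*`. -/
theorem LdualSet_disjoint [FiniteDimensional ℝ M] (W : Submodule ℝ M)
    (A : Set (Projectivization ℝ M)) (hAL : ∀ x ∈ A, x.rep ∉ W)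
    (π : Projectivization ℝ (Module.Dual ℝ M)) (hπ : π ∈ LdualSet W A)
    (h : π.rep ∈ W.dualAnnihilator) : False := by
  obtain ⟨v, hv⟩ : ∃ v, π.rep v ≠ 0 := by
    by_contra! hc
    exact π.rep_nonzero (LinearMap.ext hc)
  rw [Submodule.mem_dualAnnihilator] at h
  have hvW : v ∉ W := fun hh => hv (h v hh)
  obtain ⟨y, hyA, hy, hyN⟩ := hπ (W ⊔ Submodule.span ℝ {v}) le_sup_left
    (Submodule.finrank_sup_span_singleton hvW)
  obtain ⟨w, hw, z, hz, hwz⟩ := Submodule.mem_sup.mp hyN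
  obtain ⟨c, rfl⟩ := Submodule.mem_span_singleton.mp hz
  unfold Incident at hy
  rw [← hwz, map_add, h w hw, map_smul, zero_add, smul_eq_mul] at hy
  have hc := (mul_eq_zero.mp hy).resolve_right hv
  apply hAL y hyA
  rw [← hwz, hc]
  simpa using hw

/-- If `A ⊆ ℝPⁿ` is disjoint from `L = ℙ(W)` and every section `A ∩ N`
by a projective subspace `N ⊇ L` with `dim N = dim L + 1` is projectively separable
as a subset of the projective space `N`, then `(A^⊥_L)^⊥_{L*} ⊆ A`. -/
theorem statement8 (n : ℕ) (W : Submodule ℝ (Vec n)) (hW : W ≠ ⊥) (A : Set (Pt n))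
    (hAL : ∀ x ∈ A, x.rep ∉ W)
    (hsep : ∀ N : Submodule ℝ (Vec n), W ≤ N → finrank ℝ N = finrank ℝ W + 1 →
      ∀ x : Pt n, x.rep ∈ N → x ∉ A →
        ∃ P : Submodule ℝ (Vec n), P ≤ N ∧ finrank ℝ P + 1 = finrank ℝ N ∧
          x.rep ∈ P ∧ ∀ y ∈ A, y.rep ∈ N → y.rep ∉ P) :
    Lbidual W A ⊆ A := by
  intro x hx
  have key : ∀ f : Module.Dual ℝ (Vec n), f ∉ W.dualAnnihilator →
      ∃ π ∈ LdualSet W A, π.rep x.rep = 0 ∧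
        ∃ g ∈ W.dualAnnihilator, ∃ c : ℝ, g + c • f = π.rep := by
    intro f hf
    obtain ⟨π, hπ, hi, hN⟩ := hx (W.dualAnnihilator ⊔ Submodule.span ℝ {f}) le_sup_left
      (Submodule.finrank_sup_span_singleton hf)
    obtain ⟨g, hg, z, hz, hgz⟩ := Submodule.mem_sup.mp hN
    obtain ⟨c, rfl⟩ := Submodule.mem_span_singleton.mp hz
    exact ⟨π, hπ, incident_toDoubleDual x π hi, g, hg, c, hgz⟩
  by_contra hxA
  by_cases hxW : x.rep ∈ W
  · obtain ⟨f, hf⟩ := Module.Projective.exists_dual_ne_zero ℝ x.rep_nonzero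
    obtain ⟨π, hπ, hi, g, hg, c, hgc⟩ := key f
      (fun h => hf ((Submodule.mem_dualAnnihilator _).mp h _ hxW))
    have hgx := (Submodule.mem_dualAnnihilator _).mp hg _ hxW
    rw [← hgc, LinearMap.add_apply, hgx, LinearMap.smul_apply, zero_add, smul_eq_mul] at hi
    have hc := (mul_eq_zero.mp hi).resolve_right hf
    refine LdualSet_disjoint W A hAL π hπ ?_
    rw [← hgc, hc]
    simpa using hg
  · have hNr := Submodule.finrank_sup_span_singleton hxW
    have hxN : x.rep ∈ W ⊔ Submodule.span ℝ {x.rep} :=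
      Submodule.mem_sup_right (Submodule.mem_span_singleton_self _)
    obtain ⟨P, hPN, hPr, hxP, hPA⟩ := hsep _ le_sup_left hNr x hxN hxA
    have hWP : ¬ W ≤ P := by
      intro hle
      have := Submodule.eq_of_le_of_finrank_eq hle (by omega)
      exact hxW (this ▸ hxP)
    obtain ⟨w, hwW, hwP⟩ := SetLike.not_le_iff_exists.mp hWP
    obtain ⟨f, hfw, hfP⟩ := Submodule.exists_le_ker_of_notMem hwP
    obtain ⟨π, hπ, hi, g, hg, c, hgc⟩ := key f
      (fun h => hfw ((Submodule.mem_dualAnnihilator _).mp h _ hwW))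
    have hfx : f x.rep = 0 := hfP hxP
    rw [← hgc, LinearMap.add_apply, LinearMap.smul_apply, hfx, smul_zero, add_zero] at hi
    have hgN : W ⊔ Submodule.span ℝ {x.rep} ≤ LinearMap.ker g := by
      refine sup_le (fun v hv => (Submodule.mem_dualAnnihilator _).mp hg v hv) ?_
      rw [Submodule.span_singleton_le_iff_mem]
      exact hi
    obtain ⟨y, hyA, hy, hyN⟩ := hπ _ le_sup_left hNr
    have hgy : g y.rep = 0 := hgN hyN
    unfold Incident at hy
    rw [← hgc, LinearMap.add_apply, hgy, LinearMap.smul_apply, zero_add, smul_eq_mul] at hy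
    rcases mul_eq_zero.mp hy with hc | hfy
    · refine LdualSet_disjoint W A hAL π hπ ?_
      rw [← hgc, hc]
      simpa using hg
    · have hlt : LinearMap.ker f ⊓ (W ⊔ Submodule.span ℝ {x.rep})
          < W ⊔ Submodule.span ℝ {x.rep} := by
        refine lt_of_le_of_ne inf_le_right fun heq => ?_
        have : w ∈ LinearMap.ker f ⊓ (W ⊔ Submodule.span ℝ {x.rep}) := by
          rw [heq]; exact Submodule.mem_sup_left hwW
        exact hfw this.1
      have hr := Submodule.finrank_lt_finrank_of_lt hlt
      have hPeq := Submodule.eq_of_le_of_finrank_le (le_inf hfP hPN) (by omega)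
      apply hPA y hyA hyN
      rw [hPeq]
      exact ⟨hfy, hyN⟩

end CC
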